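/- arXiv:2012.09956 — 2 statements merged into one kernel-verified Lean document; each statement's English description precedes it below -/
import Mathlib

section
/- Let c be a real number and let h : ℕ → ℝ satisfy h(n)/n² → 0 as n → ∞. If every SED-pair of order n satisfies s[(G,f)] ≥ c·n² + h(n), then every SED-pair of order n satisfies s[(G,f)] ≥ c·n². -/
open Finset

/-- The value `s_v`: the sum of weights of edges incident to `v`. -/
def sVert {V : Type*} [Fintype V] [DecidableEq V] (G : SimpleGraph V) [DecidableRel G.Adj]
    (f : Sym2 V → ℤ) (v : V) : ℤ :=
  ∑ e ∈ G.edgeFinset.filter (fun e => v ∈ e), f e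

/-- The total weight `s[(G,f)]`: the sum of weights over all edges. -/
def sSum {V : Type*} [Fintype V] [DecidableEq V] (G : SimpleGraph V) [DecidableRel G.Adj]
    (f : Sym2 V → ℤ) : ℤ :=
  ∑ e ∈ G.edgeFinset, f e

/-- `(G, f)` is a SED-pair: `f` takes values `±1` on edges, and the sum of `f` over the
closed edge-neighborhood `N[e]` (edges sharing a vertex with `e`, including `e` itself)
is at least `1` for every edge `e`. -/
def IsSEDPair {V : Type*} [Fintype V] [DecidableEq V] (G : SimpleGraph V) [DecidableRel G.Adj]
    (f : Sym2 V → ℤ) : Prop :=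
  (∀ e ∈ G.edgeFinset, f e = 1 ∨ f e = -1) ∧
  (∀ e ∈ G.edgeFinset,
    1 ≤ ∑ e' ∈ G.edgeFinset.filter (fun e' => ∃ v, v ∈ e ∧ v ∈ e'), f e')


section BlowUp

variable {V : Type*} [Fintype V] [DecidableEq V] (G : SimpleGraph V) [DecidableRel G.Adj]
  (f : Sym2 V → ℤ)

/-- `s_v` as a sum over the neighbours of `v`. -/
lemma sVert_eq_sum_neighbors (v : V) :
    sVert G f v = ∑ w, if G.Adj v w then f s(v, w) else 0 := by
  have himage : G.edgeFinset.filter (fun e => v ∈ e)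
      = (univ.filter (G.Adj v)).image (fun w => s(v, w)) := by
    ext e
    induction e with
    | _ a b =>
      simp only [mem_filter, SimpleGraph.mem_edgeFinset, SimpleGraph.mem_edgeSet, Sym2.mem_iff,
        mem_image, mem_univ, true_and]
      constructor
      · rintro ⟨hab, rfl | rfl⟩
        · exact ⟨b, hab, rfl⟩
        · exact ⟨a, hab.symm, Sym2.eq_swap⟩
      · rintro ⟨w, hw, hs⟩
        rcases Sym2.eq_iff.mp hs with ⟨rfl, rfl⟩ | ⟨rfl, rfl⟩
        · exact ⟨hw, Or.inl rfl⟩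
        · exact ⟨hw.symm, Or.inr rfl⟩
  rw [sVert, himage, sum_image (fun _ _ _ _ hs => Sym2.congr_right.mp hs), sum_filter]

/-- Every edge is counted at both of its endpoints. -/
lemma sum_sVert : ∑ v, sVert G f v = 2 * sSum G f := by
  simp only [sVert, sSum, sum_filter]
  rw [sum_comm, mul_sum]
  refine sum_congr rfl fun e he => ?_
  induction e with
  | _ a b =>
    have hab : a ≠ b := (SimpleGraph.mem_edgeFinset.mp he : G.Adj a b).ne
    have hends : univ.filter (fun v => v ∈ s(a, b)) = {a, b} := by
      ext v
      simp
    rw [← sum_filter, hends, sum_pair hab, two_mul]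

/-- The weight of a closed edge-neighbourhood in terms of the endpoint sums. -/
lemma sum_closedNeighborhood {u v : V} (huv : G.Adj u v) :
    ∑ e ∈ G.edgeFinset.filter (fun e => ∃ w, w ∈ s(u, v) ∧ w ∈ e), f e
      = sVert G f u + sVert G f v - f s(u, v) := by
  have hunion : G.edgeFinset.filter (fun e => ∃ w, w ∈ s(u, v) ∧ w ∈ e)
      = G.edgeFinset.filter (fun e => u ∈ e) ∪ G.edgeFinset.filter (fun e => v ∈ e) := by
    ext e
    simp [← and_or_left]
  have hinter : G.edgeFinset.filter (fun e => u ∈ e) ∩ G.edgeFinset.filter (fun e => v ∈ e)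
      = {s(u, v)} := by
    ext e
    rw [← filter_and, mem_filter, Sym2.mem_and_mem_iff huv.ne, mem_singleton]
    exact ⟨And.right, fun he => ⟨by simpa [he] using huv, he⟩⟩
  have hsum := sum_union_inter (f := f) (s₁ := G.edgeFinset.filter (fun e => u ∈ e))
    (s₂ := G.edgeFinset.filter (fun e => v ∈ e))
  rw [hinter, sum_singleton] at hsum
  rw [hunion, sVert, sVert]
  linarith

lemma isSEDPair_iff :
    IsSEDPair G f ↔ ∀ u v, G.Adj u v →
      (f s(u, v) = 1 ∨ f s(u, v) = -1) ∧ 1 ≤ sVert G f u + sVert G f v - f s(u, v) := by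
  constructor
  · rintro ⟨hval, hsum⟩ u v huv
    have he : s(u, v) ∈ G.edgeFinset := SimpleGraph.mem_edgeFinset.mpr huv
    exact ⟨hval _ he, sum_closedNeighborhood G f huv ▸ hsum _ he⟩
  · refine fun hadj => ⟨fun e he => ?_, fun e he => ?_⟩ <;> induction e with
    | _ u v =>
      have huv : G.Adj u v := SimpleGraph.mem_edgeFinset.mp he
      first
        | exact (hadj u v huv).1
        | exact (sum_closedNeighborhood G f huv).symm ▸ (hadj u v huv).2

/-- In the blow-up replacing each vertex by copies indexed by `ι`, endpoint sums are
multiplied by the number of copies. -/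
lemma sVert_blowUp (ι : Type*) [Fintype ι] [DecidableEq ι]
    [DecidableRel (G.comap (Prod.fst : V × ι → V)).Adj] (p : V × ι) :
    sVert (G.comap (Prod.fst : V × ι → V)) (f ∘ Sym2.map Prod.fst) p
      = Fintype.card ι * sVert G f p.1 := by
  simp [sVert_eq_sum_neighbors, Fintype.sum_prod_type, mul_sum]

lemma sSum_blowUp (ι : Type*) [Fintype ι] [DecidableEq ι]
    [DecidableRel (G.comap (Prod.fst : V × ι → V)).Adj] :
    sSum (G.comap (Prod.fst : V × ι → V)) (f ∘ Sym2.map Prod.fst)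
      = (Fintype.card ι : ℤ) ^ 2 * sSum G f := by
  have hblow := sum_sVert (G.comap (Prod.fst : V × ι → V)) (f ∘ Sym2.map Prod.fst)
  simp only [sVert_blowUp, Fintype.sum_prod_type, sum_const, card_univ, nsmul_eq_mul,
    ← mul_sum, sum_sVert] at hblow
  linarith

lemma IsSEDPair.blowUp {G : SimpleGraph V} [DecidableRel G.Adj] {f : Sym2 V → ℤ}
    (hf : IsSEDPair G f) (ι : Type*) [Fintype ι] [DecidableEq ι]
    [DecidableRel (G.comap (Prod.fst : V × ι → V)).Adj] :
    IsSEDPair (G.comap (Prod.fst : V × ι → V)) (f ∘ Sym2.map Prod.fst) := by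
  rw [isSEDPair_iff] at hf ⊢
  intro p q hpq
  obtain ⟨hval, hsum⟩ := hf p.1 q.1 hpq
  refine ⟨by simpa using hval, ?_⟩
  have hcard : (1 : ℤ) ≤ Fintype.card ι := by
    exact_mod_cast Fintype.card_pos_iff.mpr ⟨p.2⟩
  simp only [sVert_blowUp, Function.comp_apply, Sym2.map_mk]
  rcases hval with hval | hval <;> rw [hval] at hsum ⊢ <;> nlinarith

end BlowUp

/-- Let `c : ℝ` and `h : ℕ → ℝ` with `h n / n² → 0`. If every SED-pair of
order `n` satisfies `s[(G,f)] ≥ c·n² + h n`, then every SED-pair of order `n` satisfies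
`s[(G,f)] ≥ c·n²`. -/
theorem sed_asymptotic_bound_improves (c : ℝ) (h : ℕ → ℝ)
    (hh : Filter.Tendsto (fun n : ℕ => h n / (n : ℝ) ^ 2) Filter.atTop (nhds 0))
    (H : ∀ (V : Type) [Fintype V] [DecidableEq V] (G : SimpleGraph V)
      [DecidableRel G.Adj] (f : Sym2 V → ℤ), IsSEDPair G f →
      (sSum G f : ℝ) ≥ c * (Fintype.card V : ℝ) ^ 2 + h (Fintype.card V)) :
    ∀ (V : Type) [Fintype V] [DecidableEq V] (G : SimpleGraph V)
      [DecidableRel G.Adj] (f : Sym2 V → ℤ), IsSEDPair G f →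
      (sSum G f : ℝ) ≥ c * (Fintype.card V : ℝ) ^ 2 := by
  intro V _ _ G _ f hf
  classical
  rcases Nat.eq_zero_or_pos (Fintype.card V) with hn | hn
  · have := Fintype.card_eq_zero_iff.mp hn
    have hs : sSum G f = 0 := by
      have := sum_sVert G f
      simp only [univ_eq_empty, sum_empty] at this
      omega
    simp [hs]
  set n := Fintype.card V
  have hn' : (0 : ℝ) < n := by exact_mod_cast hn
  have hmul : Filter.Tendsto (fun k : ℕ => n * k) Filter.atTop Filter.atTop :=
    Filter.tendsto_id.const_mul_atTop' hn
  have hlim : Filter.Tendsto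
      (fun k : ℕ => c * (n : ℝ) ^ 2 + (n : ℝ) ^ 2 * (h (n * k) / ((n * k : ℕ) : ℝ) ^ 2))
      Filter.atTop (nhds (c * (n : ℝ) ^ 2)) := by
    simpa using ((hh.comp hmul).const_mul ((n : ℝ) ^ 2)).const_add (c * (n : ℝ) ^ 2)
  refine le_of_tendsto hlim ?_
  filter_upwards [Filter.eventually_gt_atTop 0] with k hk
  have hk' : (0 : ℝ) < k := by exact_mod_cast hk
  have hbound := H (V × Fin k) (G.comap Prod.fst) _ (hf.blowUp (Fin k))
  rw [sSum_blowUp, Fintype.card_prod, Fintype.card_fin] at hbound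
  push_cast at hbound ⊢
  have hscale : c * (n : ℝ) ^ 2 + (n : ℝ) ^ 2 * (h (n * k) / ((n : ℝ) * k) ^ 2)
      = (c * ((n : ℝ) * k) ^ 2 + h (n * k)) / (k : ℝ) ^ 2 := by
    field_simp
  rw [hscale, div_le_iff₀ (by positivity)]
  linarith
end

section
/- Let (G,f) be a SED-pair such that every edge e with f(e) = −1 joins a vertex of V_+ with a vertex of V_−, and every edge e with f(e) = +1 joins two vertices of V_+. For each u ∈ V_+, let a_u be the number of edges joining u to vertices of V_+ and b_u the number of edges joining u to vertices of V_−. Then ∑_{u∈V_+} (a_u − b_u)·b_u ≥ ∑_{w∈V_−} (deg w)², where deg w denotes the degree of w in G. -/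
open Finset

/-- The vertex weight `s_u` as a sum over the neighbours of `u`. -/
theorem sVert_eq_sum_neighborFinset {V : Type*} [Fintype V] [DecidableEq V]
    (G : SimpleGraph V) [DecidableRel G.Adj] (f : Sym2 V → ℤ) (u : V) :
    sVert G f u = ∑ v ∈ G.neighborFinset u, f s(u, v) := by
  symm
  refine Finset.sum_bij (fun v _ => s(u, v)) ?_ ?_ ?_ fun _ _ => rfl
  · intro v hv
    simpa using hv
  · intro v _ w _ hvw
    exact Sym2.congr_right.mp hvw
  · intro e he
    obtain ⟨he, v, rfl⟩ := Finset.mem_filter.mp he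
    exact ⟨v, by simpa using he, rfl⟩

/-- The weight of the closed neighbourhood of an edge `uw` is `s_u + s_w - f(uw)`. -/
theorem sum_closedEdgeNeighborhood_add {V : Type*} [Fintype V] [DecidableEq V]
    (G : SimpleGraph V) [DecidableRel G.Adj] (f : Sym2 V → ℤ) {u w : V} (huw : G.Adj u w) :
    ∑ e ∈ G.edgeFinset.filter (fun e => ∃ v, v ∈ s(u, w) ∧ v ∈ e), f e + f s(u, w) =
      sVert G f u + sVert G f w := by
  have hunion : G.edgeFinset.filter (fun e => ∃ v, v ∈ s(u, w) ∧ v ∈ e) =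
      G.edgeFinset.filter (fun e => u ∈ e) ∪ G.edgeFinset.filter (fun e => w ∈ e) := by
    rw [← Finset.filter_or]
    simp
  have hinter : G.edgeFinset.filter (fun e => u ∈ e) ∩ G.edgeFinset.filter (fun e => w ∈ e) =
      {s(u, w)} := by
    rw [← Finset.filter_and]
    ext e
    simp only [Finset.mem_filter, Finset.mem_singleton, Sym2.mem_and_mem_iff huw.ne]
    refine ⟨fun he => he.2, ?_⟩
    rintro rfl
    exact ⟨by simpa using huw, rfl⟩
  rw [hunion, sVert, sVert, ← Finset.sum_union_inter, hinter, Finset.sum_singleton]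

/-- Let `(G, f)` be a SED-pair in which every edge of weight `-1` joins a
vertex of `V₊` with a vertex of `V₋`, and every edge of weight `+1` joins two vertices of
`V₊`. For `u ∈ V₊` let `a_u` (resp. `b_u`) be the number of edges joining `u` to vertices
of `V₊` (resp. `V₋`). Then `∑_{u ∈ V₊} (a_u - b_u)·b_u ≥ ∑_{w ∈ V₋} (deg w)²`. -/
theorem sed_degree_sum_ineq {V : Type*} [Fintype V] [DecidableEq V]
    (G : SimpleGraph V) [DecidableRel G.Adj] (f : Sym2 V → ℤ)
    (h : IsSEDPair G f)
    (hneg : ∀ u w : V, G.Adj u w → f s(u, w) = -1 →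
      (0 ≤ sVert G f u ∧ sVert G f w < 0) ∨ (0 ≤ sVert G f w ∧ sVert G f u < 0))
    (hpos : ∀ u w : V, G.Adj u w → f s(u, w) = 1 →
      0 ≤ sVert G f u ∧ 0 ≤ sVert G f w) :
    ∑ u ∈ univ.filter (fun v => 0 ≤ sVert G f v),
        ((((G.neighborFinset u).filter (fun v => 0 ≤ sVert G f v)).card : ℤ) -
            (((G.neighborFinset u).filter (fun v => sVert G f v < 0)).card : ℤ)) *
          (((G.neighborFinset u).filter (fun v => sVert G f v < 0)).card : ℤ) ≥
      ∑ w ∈ univ.filter (fun v => sVert G f v < 0), (G.degree w : ℤ) ^ 2 := by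
  have weight_of_neg : ∀ u w, G.Adj u w → sVert G f w < 0 → f s(u, w) = -1 := by
    intro u w huw hw
    rcases h.1 s(u, w) (by simpa using huw) with hf | hf
    · exact absurd (hpos u w huw hf).2 (not_le.mpr hw)
    · exact hf
  have weight_of_nonneg : ∀ u w, G.Adj u w → 0 ≤ sVert G f u → 0 ≤ sVert G f w →
      f s(u, w) = 1 := by
    intro u w huw hu hw
    rcases h.1 s(u, w) (by simpa using huw) with hf | hf
    · exact hf
    · rcases hneg u w huw hf with h' | h' <;> omega
  have nonneg_of_neg : ∀ u w, G.Adj u w → sVert G f w < 0 → 0 ≤ sVert G f u := by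
    intro u w huw hw
    rcases hneg u w huw (weight_of_neg u w huw hw) with h' | h' <;> omega
  have sVert_nonneg_eq : ∀ u, 0 ≤ sVert G f u → sVert G f u =
      (((G.neighborFinset u).filter (fun v => 0 ≤ sVert G f v)).card : ℤ) -
        (((G.neighborFinset u).filter (fun v => sVert G f v < 0)).card : ℤ) := by
    intro u hu
    have hplus : ∑ v ∈ (G.neighborFinset u).filter (fun v => 0 ≤ sVert G f v), f s(u, v) =
        (((G.neighborFinset u).filter (fun v => 0 ≤ sVert G f v)).card : ℤ) := by
      rw [Finset.sum_congr rfl (g := fun _ => (1 : ℤ))]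
      · simp
      · intro v hv
        simp only [Finset.mem_filter, SimpleGraph.mem_neighborFinset] at hv
        exact weight_of_nonneg u v hv.1 hu hv.2
    have hminus : ∑ v ∈ (G.neighborFinset u).filter (fun v => sVert G f v < 0), f s(u, v) =
        -(((G.neighborFinset u).filter (fun v => sVert G f v < 0)).card : ℤ) := by
      rw [Finset.sum_congr rfl (g := fun _ => (-1 : ℤ))]
      · simp
      · intro v hv
        simp only [Finset.mem_filter, SimpleGraph.mem_neighborFinset] at hv
        exact weight_of_neg u v hv.1 hv.2
    rw [sVert_eq_sum_neighborFinset, ← Finset.sum_filter_add_sum_filter_not _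
      (fun v => 0 ≤ sVert G f v), hplus]
    simp only [not_le]
    rw [hminus, sub_eq_add_neg]
  have sVert_neg_eq : ∀ w, sVert G f w < 0 → sVert G f w = -(G.degree w : ℤ) := by
    intro w hw
    rw [sVert_eq_sum_neighborFinset, Finset.sum_congr rfl (g := fun _ => (-1 : ℤ))]
    · simp
    · intro v hv
      rw [SimpleGraph.mem_neighborFinset] at hv
      rw [Sym2.eq_swap]
      exact weight_of_neg v w hv.symm hw
  have degree_le : ∀ u w, G.Adj u w → sVert G f w < 0 → (G.degree w : ℤ) ≤ sVert G f u := by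
    intro u w huw hw
    have hsed := h.2 s(u, w) (by simpa using huw)
    have hsum := sum_closedEdgeNeighborhood_add G f huw
    have hf := weight_of_neg u w huw hw
    have hdeg := sVert_neg_eq w hw
    omega
  calc ∑ w ∈ univ.filter (fun v => sVert G f v < 0), (G.degree w : ℤ) ^ 2
      = ∑ w ∈ univ.filter (fun v => sVert G f v < 0),
          ∑ _u ∈ G.neighborFinset w, (G.degree w : ℤ) := by
        simp [sq]
    _ = ∑ u ∈ univ.filter (fun v => 0 ≤ sVert G f v),
          ∑ w ∈ (G.neighborFinset u).filter (fun v => sVert G f v < 0), (G.degree w : ℤ) := by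
        refine Finset.sum_comm' fun w u => ?_
        simp only [Finset.mem_filter, Finset.mem_univ, true_and, SimpleGraph.mem_neighborFinset]
        exact ⟨fun ⟨hw, hwu⟩ => ⟨⟨hwu.symm, hw⟩, nonneg_of_neg u w hwu.symm hw⟩,
          fun ⟨⟨huw, hw⟩, _⟩ => ⟨hw, huw.symm⟩⟩
    _ ≤ ∑ u ∈ univ.filter (fun v => 0 ≤ sVert G f v),
          ∑ _w ∈ (G.neighborFinset u).filter (fun v => sVert G f v < 0), sVert G f u := by
        refine Finset.sum_le_sum fun u _ => Finset.sum_le_sum fun w hw => ?_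
        simp only [Finset.mem_filter, SimpleGraph.mem_neighborFinset] at hw
        exact degree_le u w hw.1 hw.2
    _ = _ := by
        refine Finset.sum_congr rfl fun u hu => ?_
        rw [← sVert_nonneg_eq u (Finset.mem_filter.mp hu).2, Finset.sum_const, nsmul_eq_mul,
          mul_comm]
end
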